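/- (Strong duality theorem II) Suppose X is a real Banach space and the set D − dom f = {d − x : d ∈ D, x ∈ dom f} is closed in X. If one of the problems (P), (D) has a solution, then both have solutions and the optimal values of (P) and (D) are equal. -/

import Mathlib

open scoped Pointwise

/-- A generalized polyhedral convex set: the intersection of a closed affine subspace
with finitely many closed half-spaces. -/
def IsGPCS {X : Type*} [AddCommGroup X] [Module ℝ X] [TopologicalSpace X] (S : Set X) : Prop :=
  ∃ (p : ℕ) (xs : Fin p → X →L[ℝ] ℝ) (α : Fin p → ℝ) (L : AffineSubspace ℝ X),
    IsClosed (L : Set X) ∧ S = {x | x ∈ L ∧ ∀ i, xs i x ≤ α i}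

theorem farkas_aux {W : Type*} [AddCommGroup W] [Module ℝ W] {ι : Type*} [DecidableEq ι]
    (s : Finset ι) : ∀ (a : ι → W →ₗ[ℝ] ℝ) (b : W →ₗ[ℝ] ℝ),
    (∀ w, (∀ i ∈ s, a i w ≤ 0) → b w ≤ 0) →
    ∃ l : ι → ℝ, (∀ i, 0 ≤ l i) ∧ ∀ w, b w = ∑ i ∈ s, l i * a i w := by
  induction s using Finset.induction_on with
  | empty =>
    intro a b h
    refine ⟨fun _ => 0, fun _ => le_rfl, fun w => ?_⟩
    have h1 := h w (by simp)
    have h2 := h (-w) (by simp)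
    simp at h2 ⊢
    linarith
  | insert n s hn ih =>
    intro a b h
    by_cases hb : ∀ w, (∀ i ∈ s, a i w ≤ 0) → b w ≤ 0
    · obtain ⟨l, hl, hs⟩ := ih a b hb
      refine ⟨fun i => if i = n then 0 else l i, fun i => ?_, fun w => ?_⟩
      · dsimp only
        split_ifs
        · exact le_rfl
        · exact hl i
      · rw [Finset.sum_insert hn, hs w]
        simp only [if_true, zero_mul, zero_add]
        refine Finset.sum_congr rfl fun i hi => ?_
        rw [if_neg]
        rintro rfl
        exact hn hi
    · push Not at hb
      obtain ⟨w0, hw0, hbw0⟩ := hb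
      have hpos : 0 < a n w0 := by
        by_contra hcon
        push Not at hcon
        have := h w0 (by
          intro i hi
          rcases Finset.mem_insert.1 hi with rfl | hi
          · exact hcon
          · exact hw0 i hi)
        linarith
      obtain ⟨c, hc, hc0⟩ : ∃ c : ℝ, c * a n w0 = 1 ∧ 0 < c :=
        ⟨(a n w0)⁻¹, inv_mul_cancel₀ hpos.ne', inv_pos.2 hpos⟩
      obtain ⟨l, hl, hs⟩ := ih (fun i => a i - (c * a i w0) • a n) (b - (c * b w0) • a n) (by
        intro w hw
        have := h (w - (c * a n w) • w0) (by
          intro i hi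
          rcases Finset.mem_insert.1 hi with rfl | hi
          · simp only [map_sub, map_smul, smul_eq_mul]
            exact le_of_eq (by linear_combination (-(a i w)) * hc)
          · have := hw i hi
            simp at this ⊢
            linarith)
        simp at this ⊢
        linarith)
      refine ⟨fun i => if i = n then c * b w0 - ∑ j ∈ s, l j * (c * a j w0) else l i,
        fun i => ?_, fun w => ?_⟩
      · dsimp only
        split_ifs
        · have h1 : ∑ j ∈ s, l j * (c * a j w0) ≤ 0 := by
            refine Finset.sum_nonpos fun j hj => ?_
            exact mul_nonpos_of_nonneg_of_nonpos (hl j)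
              (mul_nonpos_of_nonneg_of_nonpos hc0.le (hw0 j hj))
          have := mul_pos hc0 hbw0
          linarith
        · exact hl i
      · rw [Finset.sum_insert hn]
        have h1 : ∑ i ∈ s, (if i = n then c * b w0 - ∑ j ∈ s, l j * (c * a j w0) else l i) * a i w
            = ∑ i ∈ s, l i * a i w := by
          refine Finset.sum_congr rfl fun i hi => ?_
          rw [if_neg]
          rintro rfl
          exact hn hi
        rw [h1]
        have h2 := hs w
        simp only [LinearMap.sub_apply, LinearMap.smul_apply, smul_eq_mul, mul_sub,
          Finset.sum_sub_distrib] at h2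
        have h3 : ∑ i ∈ s, l i * (c * a i w0 * a n w)
            = (∑ i ∈ s, l i * (c * a i w0)) * a n w := by
          rw [Finset.sum_mul]
          exact Finset.sum_congr rfl fun i _ => by ring
        rw [h3] at h2
        simp only [if_true]
        linarith

theorem farkas_lin {W : Type*} [AddCommGroup W] [Module ℝ W] {ι : Type*} [Fintype ι]
    (a : ι → W →ₗ[ℝ] ℝ) (b : W →ₗ[ℝ] ℝ) (h : ∀ w, (∀ i, a i w ≤ 0) → b w ≤ 0) :
    ∃ l : ι → ℝ, (∀ i, 0 ≤ l i) ∧ ∀ w, b w = ∑ i, l i * a i w := by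
  classical
  exact farkas_aux Finset.univ a b (fun w hw => h w fun i => hw i (Finset.mem_univ i))

/-- Gale alternative. -/
theorem gale_alt {W : Type*} [AddCommGroup W] [Module ℝ W] {ι : Type*} [Fintype ι]
    (a : ι → W →ₗ[ℝ] ℝ) (b : ι → ℝ) (h : ¬ ∃ w, ∀ i, a i w ≤ b i) :
    ∃ l : ι → ℝ, (∀ i, 0 ≤ l i) ∧ (∀ w, ∑ i, l i * a i w = 0) ∧ ∑ i, l i * b i = -1 := by
  obtain ⟨l, hl, hs⟩ := farkas_lin (W := W × ℝ)
    (fun i => (a i).comp (LinearMap.fst ℝ W ℝ) - (b i) • LinearMap.snd ℝ W ℝ)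
    (LinearMap.snd ℝ W ℝ) (by
      rintro ⟨w, s⟩ hw
      by_contra hcon
      simp at hcon
      refine h ⟨s⁻¹ • w, fun i => ?_⟩
      have := hw i
      simp at this
      rw [map_smul, smul_eq_mul, inv_mul_le_iff₀ hcon]
      linarith)
  refine ⟨l, hl, fun w => ?_, ?_⟩
  · have := hs (w, 0)
    simpa using this.symm
  · have := hs (0, 1)
    simp at this
    linarith

/-- attainment -/
theorem lp_attain {W : Type*} [AddCommGroup W] [Module ℝ W] {ι κ : Type*} [Fintype ι] [Fintype κ]
    (a : ι → W →ₗ[ℝ] ℝ) (b : ι → ℝ) (c : κ → W →ₗ[ℝ] ℝ) (d : κ → ℝ) (mu : ℝ)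
    (h : ∀ e > 0, ∃ w, (∀ i, a i w ≤ b i) ∧ ∀ k, c k w + d k ≤ mu + e) :
    ∃ w, (∀ i, a i w ≤ b i) ∧ ∀ k, c k w + d k ≤ mu := by
  by_contra hcon
  obtain ⟨l, hl, h0, h1⟩ := gale_alt (ι := ι ⊕ κ) (Sum.elim a c) (Sum.elim b fun k => mu - d k) (by
    rintro ⟨w, hw⟩
    refine hcon ⟨w, fun i => hw (Sum.inl i), fun k => ?_⟩
    have := hw (Sum.inr k)
    simp at this
    linarith)
  simp only [Fintype.sum_sum_type, Sum.elim_inl, Sum.elim_inr] at h0 h1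
  set S := ∑ k, l (Sum.inr k) with hS
  have hS0 : 0 ≤ S := Finset.sum_nonneg fun k _ => hl _
  have he : 0 < 1 / (2 * (S + 1)) := by positivity
  obtain ⟨w, hw1, hw2⟩ := h _ he
  have e1 : ∑ i, l (Sum.inl i) * a i w ≤ ∑ i, l (Sum.inl i) * b i :=
    Finset.sum_le_sum fun i _ => mul_le_mul_of_nonneg_left (hw1 i) (hl _)
  have e2 : ∑ k, l (Sum.inr k) * c k w ≤
      ∑ k, (l (Sum.inr k) * (mu - d k) + l (Sum.inr k) * (1 / (2 * (S + 1)))) := by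
    refine Finset.sum_le_sum fun k _ => ?_
    rw [← mul_add]
    exact mul_le_mul_of_nonneg_left (by linarith [hw2 k]) (hl _)
  rw [Finset.sum_add_distrib, ← Finset.sum_mul, ← hS] at e2
  have e3 : S * (1 / (2 * (S + 1))) < 1 := by
    rw [mul_one_div, div_lt_one (by positivity)]
    linarith
  have := h0 w
  linarith

/-- Lagrange multipliers at an optimal point `0`. -/
theorem lp_mult {W : Type*} [AddCommGroup W] [Module ℝ W] {ι κ : Type*} [Fintype ι] [Fintype κ]
    (a : ι → W →ₗ[ℝ] ℝ) (p : ι → ℝ) (c : κ → W →ₗ[ℝ] ℝ) (q : κ → ℝ)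
    (hp : ∀ i, p i ≤ 0) (hq : ∀ k, q k ≤ 0)
    (h : ∀ w, (∀ i, a i w + p i ≤ 0) → ∃ k, 0 ≤ c k w + q k) :
    ∃ (l : ι → ℝ) (r : κ → ℝ), (∀ i, 0 ≤ l i) ∧ (∀ k, 0 ≤ r k) ∧ ∑ k, r k = 1 ∧
      (∀ w, ∑ i, l i * a i w + ∑ k, r k * c k w = 0) ∧
      (∀ i, l i * p i = 0) ∧ (∀ k, r k * q k = 0) := by
  obtain ⟨l, hl, hs⟩ := farkas_lin (W := W × ℝ × ℝ) (ι := (ι ⊕ κ) ⊕ Unit)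
    (Sum.elim (Sum.elim
      (fun i => (a i).comp (LinearMap.fst ℝ W (ℝ × ℝ)) +
        (p i) • (LinearMap.snd ℝ ℝ ℝ).comp (LinearMap.snd ℝ W (ℝ × ℝ)))
      (fun k => (c k).comp (LinearMap.fst ℝ W (ℝ × ℝ)) +
        (q k) • (LinearMap.snd ℝ ℝ ℝ).comp (LinearMap.snd ℝ W (ℝ × ℝ)) -
        (LinearMap.fst ℝ ℝ ℝ).comp (LinearMap.snd ℝ W (ℝ × ℝ))))
      (fun _ => -(LinearMap.snd ℝ ℝ ℝ).comp (LinearMap.snd ℝ W (ℝ × ℝ))))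
    (-(LinearMap.fst ℝ ℝ ℝ).comp (LinearMap.snd ℝ W (ℝ × ℝ))) (by
      rintro ⟨w, t, s⟩ hw
      have hs := hw (Sum.inr ())
      have ha := fun i => hw (Sum.inl (Sum.inl i))
      have hc := fun k => hw (Sum.inl (Sum.inr k))
      simp at hs ha hc ⊢
      have hs1 : 0 < s + 1 := by linarith
      obtain ⟨k, hk⟩ := h ((s + 1)⁻¹ • w) (by
        intro i
        rw [map_smul, smul_eq_mul]
        have : (s+1)⁻¹ * (a i w) ≤ (s+1)⁻¹ * (- ((s+1) * p i)) :=
          mul_le_mul_of_nonneg_left (by nlinarith [ha i, hp i]) (by positivity)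
        have h2 : (s+1)⁻¹ * (- ((s+1) * p i)) = - p i := by field_simp
        linarith)
      rw [map_smul, smul_eq_mul] at hk
      have h3 : (s+1) * ((s+1)⁻¹ * c k w + q k) = c k w + s * q k + q k := by
        field_simp; ring
      have h4 := mul_nonneg hs1.le hk
      rw [h3] at h4
      have h5 := hc k
      have h6 := hq k
      nlinarith)
  have hw := fun w => hs (w, 0, 0)
  have ht := hs (0, 1, 0)
  have hss := hs (0, 0, 1)
  simp [Fintype.sum_sum_type] at hw ht hss
  have n1 : ∀ i, l (Sum.inl (Sum.inl i)) * p i ≤ 0 :=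
    fun i => mul_nonpos_of_nonneg_of_nonpos (hl _) (hp i)
  have n2 : ∀ k, l (Sum.inl (Sum.inr k)) * q k ≤ 0 :=
    fun i => mul_nonpos_of_nonneg_of_nonpos (hl _) (hq i)
  have n3 := hl (Sum.inr ())
  have m1 := Finset.sum_nonpos (s := Finset.univ) fun i _ => n1 i
  have m2 := Finset.sum_nonpos (s := Finset.univ) fun i _ => n2 i
  refine ⟨fun i => l (Sum.inl (Sum.inl i)), fun k => l (Sum.inl (Sum.inr k)), fun i => hl _,
    fun k => hl _, by linarith, fun w => (hw w).symm, fun i => ?_, fun k => ?_⟩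
  · exact (Finset.sum_eq_zero_iff_of_nonpos fun i _ => n1 i).1 (by linarith) i (Finset.mem_univ _)
  · exact (Finset.sum_eq_zero_iff_of_nonpos fun i _ => n2 i).1 (by linarith) k (Finset.mem_univ _)

theorem fin_compl {X : Type*} [AddCommGroup X] [Module ℝ X] {ι : Type*} [Fintype ι]
    (V : Submodule ℝ X) (a : ι → X →ₗ[ℝ] ℝ) :
    ∃ F : Submodule ℝ X, FiniteDimensional ℝ F ∧ F ≤ V ∧
      V ≤ (V ⊓ LinearMap.ker (LinearMap.pi a)) ⊔ F := by
  let T := (LinearMap.pi a).domRestrict V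
  obtain ⟨s, hs⟩ := T.rangeRestrict.exists_rightInverse_of_surjective T.range_rangeRestrict
  refine ⟨(LinearMap.range s).map V.subtype, inferInstance, ?_, ?_⟩
  · exact Submodule.map_subtype_le _ _
  · intro x hx
    have h1 : x = (x - (s (T.rangeRestrict ⟨x, hx⟩) : X)) + (s (T.rangeRestrict ⟨x, hx⟩) : X) := by
      abel
    rw [h1]
    refine Submodule.add_mem_sup ⟨V.sub_mem hx (Subtype.property _), ?_⟩ ?_
    · have := congrArg Subtype.val (LinearMap.congr_fun hs (T.rangeRestrict ⟨x, hx⟩))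
      have h2 : (LinearMap.pi a) (s (T.rangeRestrict ⟨x, hx⟩) : X) = (LinearMap.pi a) x := this
      rw [SetLike.mem_coe, LinearMap.mem_ker, map_sub, h2, sub_self]
    · exact ⟨_, ⟨_, rfl⟩, rfl⟩

theorem closed_sum {X : Type*} [NormedAddCommGroup X] [NormedSpace ℝ X]
    {ι κ : Type*} [Fintype ι] [Fintype κ]
    (V1 V2 : Submodule ℝ X) (a : ι → X →ₗ[ℝ] ℝ) (b : κ → X →ₗ[ℝ] ℝ) (C : Set X) (hC : IsClosed C)
    (hsub : C ⊆ (V1 ⊔ V2 : Submodule ℝ X))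
    (hsup : ∀ x ∈ V1, (∀ i, a i x = 0) → ∀ y ∈ V2, (∀ j, b j y = 0) → x + y ∈ C) :
    IsClosed ((V1 ⊔ V2 : Submodule ℝ X) : Set X) := by
  obtain ⟨F1, hF1, hFV1, hV1⟩ := fin_compl V1 a
  obtain ⟨F2, hF2, hFV2, hV2⟩ := fin_compl V2 b
  set M := (V1 ⊓ LinearMap.ker (LinearMap.pi a)) ⊔ (V2 ⊓ LinearMap.ker (LinearMap.pi b)) with hM
  have hMC : (M : Set X) ⊆ C := by
    intro z hz
    obtain ⟨x, hx, y, hy, rfl⟩ := Submodule.mem_sup.1 hz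
    refine hsup x hx.1 (fun i => ?_) y hy.1 (fun i => ?_)
    · exact congrFun (LinearMap.mem_ker.1 hx.2) i
    · exact congrFun (LinearMap.mem_ker.1 hy.2) i
  have hcl : (M.topologicalClosure : Set X) ⊆ (V1 ⊔ V2 : Submodule ℝ X) := by
    rw [Submodule.topologicalClosure_coe]
    exact (closure_minimal hMC hC).trans hsub
  have heq : V1 ⊔ V2 = M.topologicalClosure ⊔ (F1 ⊔ F2) := by
    apply le_antisymm
    · have h1 : M ≤ M.topologicalClosure := M.le_topologicalClosure
      refine le_trans (sup_le_sup hV1 hV2) ?_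
      refine sup_le (sup_le ?_ ?_) (sup_le ?_ ?_)
      · exact (le_sup_left.trans h1).trans le_sup_left
      · exact le_sup_left.trans le_sup_right
      · exact (le_sup_right.trans h1).trans le_sup_left
      · exact le_sup_right.trans le_sup_right
    · exact sup_le hcl (sup_le_sup hFV1 hFV2)
  rw [heq]
  exact Submodule.isClosed_sup_finiteDimensional _ _ M.isClosed_topologicalClosure

theorem glue {X : Type*} [NormedAddCommGroup X] [NormedSpace ℝ X] [CompleteSpace X]
    (V1 V2 : Submodule ℝ X) (h1 : IsClosed (V1 : Set X)) (h2 : IsClosed (V2 : Set X))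
    (h : IsClosed ((V1 ⊔ V2 : Submodule ℝ X) : Set X)) (p q : X →L[ℝ] ℝ)
    (hpq : ∀ x ∈ V1, x ∈ V2 → q x + p x = 0) :
    ∃ φ : X →L[ℝ] ℝ, (∀ x ∈ V1, φ x = q x) ∧ ∀ x ∈ V2, φ x = - p x := by
  have : CompleteSpace V1 := h1.completeSpace_coe
  have : CompleteSpace V2 := h2.completeSpace_coe
  have : CompleteSpace (V1 ⊔ V2 : Submodule ℝ X) := h.completeSpace_coe
  let T : (V1 × V2) →L[ℝ] (V1 ⊔ V2 : Submodule ℝ X) :=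
    (V1.subtypeL.coprod V2.subtypeL).codRestrict _ (fun z => by
      simpa using Submodule.add_mem_sup z.1.2 z.2.2)
  have hT : ∀ z, (T z : X) = z.1 + z.2 := fun z => rfl
  have hsurj : Function.Surjective T := by
    rintro ⟨z, hz⟩
    obtain ⟨x, hx, y, hy, rfl⟩ := Submodule.mem_sup.1 hz
    exact ⟨(⟨x, hx⟩, ⟨y, hy⟩), rfl⟩
  let S : (V1 × V2) →L[ℝ] ℝ := (q.comp V1.subtypeL).coprod (-(p.comp V2.subtypeL))
  have hS : ∀ z, S z = q z.1 - p z.2 := fun z => by simp [S, sub_eq_add_neg]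
  have hker : ∀ z, T z = 0 → S z = 0 := by
    intro z hz
    have e : (z.1 : X) + z.2 = 0 := by rw [← hT, hz]; rfl
    have e1 : (z.2 : X) = - z.1 := (neg_eq_of_add_eq_zero_right e).symm
    have := hpq z.1 z.1.2 (by
      have := V2.neg_mem z.2.2
      rwa [e1, neg_neg] at this)
    rw [hS, e1, map_neg]
    linarith
  choose r hr using hsurj
  have hval : ∀ z, S (r (T z)) = S z := fun z => by
    have := hker (r (T z) - z) (by rw [map_sub, hr, sub_self])
    rw [map_sub] at this
    linarith
  let L : (V1 ⊔ V2 : Submodule ℝ X) →ₗ[ℝ] ℝ :=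
    { toFun := fun y => S (r y)
      map_add' := fun x y => by
        rw [← map_add, ← hval (r x + r y), map_add, hr, hr]
      map_smul' := fun c x => by
        rw [RingHom.id_apply, ← map_smul, ← hval (c • r x), map_smul, hr] }
  have hsurj : Function.Surjective T := fun y => ⟨r y, hr y⟩
  have hLc : Continuous L := by
    rw [(T.isQuotientMap hsurj).continuous_iff]
    have : (L ∘ T : V1 × V2 → ℝ) = S := funext hval
    rw [this]
    exact S.continuous
  obtain ⟨φ, hφ, -⟩ := _root_.exists_extension_norm_eq (V1 ⊔ V2) (⟨L, hLc⟩ : _ →L[ℝ] ℝ)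
  have key : ∀ z : V1 × V2, φ ((z.1 : X) + z.2) = q z.1 - p z.2 := fun z => by
    rw [← hT, hφ, ← hS]
    exact hval z
  refine ⟨φ, fun x hx => ?_, fun x hx => ?_⟩
  · simpa using key (⟨x, hx⟩, 0)
  · simpa using key (0, ⟨x, hx⟩)

theorem gpcs_repr {X : Type*} [NormedAddCommGroup X] [NormedSpace ℝ X] {S : Set X}
    (hS : IsGPCS S) : ∃ (p : ℕ) (xs : Fin p → X →L[ℝ] ℝ) (α : Fin p → ℝ) (V : Submodule ℝ X),
      IsClosed (V : Set X) ∧ Convex ℝ S ∧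
      ∀ u ∈ S, ∀ x, x ∈ S ↔ x - u ∈ V ∧ ∀ i, xs i x ≤ α i := by
  obtain ⟨p, xs, α, L, hL, rfl⟩ := hS
  refine ⟨p, xs, α, L.direction, L.isClosed_direction_iff.2 hL, ?_, ?_⟩
  · have h1 : {x | x ∈ L ∧ ∀ i, xs i x ≤ α i} = (L : Set X) ∩ ⋂ i, {x | xs i x ≤ α i} := by
      ext x; simp
    rw [h1]
    exact L.convex.inter (convex_iInter fun i => convex_halfSpace_le (xs i).isLinear _)
  · intro u hu x
    have := AffineSubspace.vsub_right_mem_direction_iff_mem hu.1 x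
    rw [vsub_eq_sub] at this
    rw [this]
    rfl

/-- real version of the dual attainment -/
theorem dual_attain {X : Type*} [NormedAddCommGroup X] [NormedSpace ℝ X] [CompleteSpace X]
    {D E : Set X} (hD : IsGPCS D) (hE : IsGPCS E) (hclosed : IsClosed (D - E))
    {m : ℕ} (v : Fin (m + 1) → X →L[ℝ] ℝ) (β : Fin (m + 1) → ℝ) (u : X) (huD : u ∈ D) (huE : u ∈ E)
    (mu : ℝ) (hu : ∀ k, v k u + β k ≤ mu)
    (hopt : ∀ x ∈ D, x ∈ E → ∃ k, mu ≤ v k x + β k) :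
    ∃ φ : X →L[ℝ] ℝ, ∀ x ∈ E, ∀ d ∈ D, ∀ c : ℝ, (∀ k, v k x + β k ≤ c) →
      mu ≤ c + φ x - φ d := by
  obtain ⟨p1, xs, α, V1, hV1, -, hDr⟩ := gpcs_repr hD
  obtain ⟨p2, ys, γ, V2, hV2, -, hEr⟩ := gpcs_repr hE
  have hDu := hDr u huD
  have hEu := hEr u huE
  have hN : IsClosed ((V1 ⊔ V2 : Submodule ℝ X) : Set X) := by
    refine closed_sum V1 V2 (fun i => (xs i : X →ₗ[ℝ] ℝ)) (fun i => (ys i : X →ₗ[ℝ] ℝ))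
      (D - E) hclosed ?_ ?_
    · rintro _ ⟨d, hd, e, he, rfl⟩
      have h1 := ((hDu d).1 hd).1
      have h2 := V2.neg_mem ((hEu e).1 he).1
      have h3 := Submodule.add_mem_sup h1 h2
      have h4 : d - u + -(e - u) = d - e := by abel
      rwa [h4] at h3
    · intro x hx hx0 y hy hy0
      refine ⟨u + x, (hDu _).2 ⟨by simpa using hx, fun i => ?_⟩, u - y,
        (hEu _).2 ⟨by simpa using hy, fun i => ?_⟩, by simp only; abel⟩
      · have h1 := ((hDu u).1 huD).2 i
        have h2 : xs i x = 0 := hx0 i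
        rw [map_add, h2]; linarith
      · have h1 := ((hEu u).1 huE).2 i
        have h2 : ys i y = 0 := hy0 i
        rw [map_sub, h2]; linarith
  obtain ⟨l, r, hl, hr, hr1, hz, hlp, hrq⟩ := lp_mult (W := (V1 ⊓ V2 : Submodule ℝ X))
    (ι := Fin p1 ⊕ Fin p2) (κ := Fin (m + 1))
    (Sum.elim (fun i => (xs i : X →ₗ[ℝ] ℝ).domRestrict _) (fun i => (ys i : X →ₗ[ℝ] ℝ).domRestrict _))
    (Sum.elim (fun i => xs i u - α i) (fun i => ys i u - γ i))
    (fun k => (v k : X →ₗ[ℝ] ℝ).domRestrict _) (fun k => v k u + β k - mu)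
    (by
      rintro (i | i)
      · have := ((hDu u).1 huD).2 i
        simpa using this
      · have := ((hEu u).1 huE).2 i
        simpa using this)
    (fun k => by linarith [hu k])
    (by
      rintro ⟨w, hw1, hw2⟩ hw
      obtain ⟨k, hk⟩ := hopt (u + w)
        ((hDu _).2 ⟨by simpa using hw1, fun i => by
          have := hw (Sum.inl i)
          simp at this
          rw [map_add]; linarith⟩)
        ((hEu _).2 ⟨by simpa using hw2, fun i => by
          have := hw (Sum.inr i)
          simp at this
          rw [map_add]; linarith⟩)
      refine ⟨k, ?_⟩
      rw [map_add] at hk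
      simp
      linarith)
  obtain ⟨φ, hφ1, hφ2⟩ := glue V1 V2 hV1 hV2 hN
    (∑ k, r k • v k + ∑ i, l (Sum.inr i) • ys i) (∑ i, l (Sum.inl i) • xs i) (by
      intro x hx1 hx2
      have := hz ⟨x, hx1, hx2⟩
      simp [Fintype.sum_sum_type] at this
      simp [ContinuousLinearMap.sum_apply]
      linarith)
  refine ⟨φ, fun x hx d hd c hc => ?_⟩
  have hx' := (hEu x).1 hx
  have hd' := (hDu d).1 hd
  have e1 := hφ1 _ hd'.1
  have e2 := hφ2 _ hx'.1
  have f1 : (∑ i, l (Sum.inl i) • xs i) (d - u) ≤ 0 := by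
    simp only [ContinuousLinearMap.sum_apply, ContinuousLinearMap.smul_apply, smul_eq_mul]
    refine Finset.sum_nonpos fun i _ => ?_
    have h1 := hlp (Sum.inl i)
    simp only [Sum.elim_inl] at h1
    have h2 := mul_le_mul_of_nonneg_left (hd'.2 i) (hl (Sum.inl i))
    rw [map_sub]
    linarith
  have f2 : (∑ i, l (Sum.inr i) • ys i) (x - u) ≤ 0 := by
    simp only [ContinuousLinearMap.sum_apply, ContinuousLinearMap.smul_apply, smul_eq_mul]
    refine Finset.sum_nonpos fun i _ => ?_
    have h1 := hlp (Sum.inr i)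
    simp only [Sum.elim_inr] at h1
    have h2 := mul_le_mul_of_nonneg_left (hx'.2 i) (hl (Sum.inr i))
    rw [map_sub]
    linarith
  have f3 : (∑ k, r k • v k) (x - u) ≤ c - mu := by
    simp only [ContinuousLinearMap.sum_apply, ContinuousLinearMap.smul_apply, smul_eq_mul]
    have h0 : c - mu = ∑ k, r k * (c - mu) := by rw [← Finset.sum_mul, hr1, one_mul]
    rw [h0]
    refine Finset.sum_le_sum fun k _ => ?_
    have h1 := hrq k
    have h2 := mul_le_mul_of_nonneg_left (hc k) (hr k)
    rw [map_sub]
    linarith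
  rw [ContinuousLinearMap.add_apply] at e2
  rw [map_sub φ] at e1 e2
  linarith

theorem primal_attain {X : Type*} [NormedAddCommGroup X] [NormedSpace ℝ X]
    {D E : Set X} (hD : IsGPCS D) (hE : IsGPCS E)
    {m : ℕ} (v : Fin (m + 1) → X →L[ℝ] ℝ) (β : Fin (m + 1) → ℝ) (u : X) (huD : u ∈ D) (huE : u ∈ E)
    (mu : ℝ) (h : ∀ e > 0, ∃ x ∈ D, x ∈ E ∧ ∀ k, v k x + β k ≤ mu + e) :
    ∃ x ∈ D, x ∈ E ∧ ∀ k, v k x + β k ≤ mu := by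
  obtain ⟨p1, xs, α, V1, hV1, -, hDr⟩ := gpcs_repr hD
  obtain ⟨p2, ys, γ, V2, hV2, -, hEr⟩ := gpcs_repr hE
  have hDu := hDr u huD
  have hEu := hEr u huE
  obtain ⟨w, hw, hk⟩ := lp_attain (W := (V1 ⊓ V2 : Submodule ℝ X))
    (ι := Fin p1 ⊕ Fin p2) (κ := Fin (m + 1))
    (Sum.elim (fun i => (xs i : X →ₗ[ℝ] ℝ).domRestrict _) (fun i => (ys i : X →ₗ[ℝ] ℝ).domRestrict _))
    (Sum.elim (fun i => α i - xs i u) (fun i => γ i - ys i u))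
    (fun k => (v k : X →ₗ[ℝ] ℝ).domRestrict _) (fun k => v k u + β k) mu
    (by
      intro e he
      obtain ⟨x, hxD, hxE, hx⟩ := h e he
      have h1 := (hDu x).1 hxD
      have h2 := (hEu x).1 hxE
      refine ⟨⟨x - u, h1.1, h2.1⟩, ?_, fun k => ?_⟩
      · rintro (i | i)
        · have := h1.2 i
          simpa using this
        · have := h2.2 i
          simpa using this
      · have := hx k
        simp
        linarith)
  refine ⟨u + w, (hDu _).2 ⟨by simpa using w.2.1, fun i => ?_⟩,
    (hEu _).2 ⟨by simpa using w.2.2, fun i => ?_⟩, fun k => ?_⟩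
  · have := hw (Sum.inl i)
    simp at this
    rw [map_add]; linarith
  · have := hw (Sum.inr i)
    simp at this
    rw [map_add]; linarith
  · have := hk k
    simp at this
    rw [map_add]; linarith

/-- **Strong duality theorem II.**  Suppose `X` is a real Banach space, `D` a nonempty
generalized polyhedral convex set, `f` a proper generalized polyhedral convex function,
and that `D − dom f` is closed in `X`.  If one of the problems `(P) : min {f x | x ∈ D}`
and `(D) : max {g φ}` (with `g φ = −f*(−φ) − sup_{x ∈ D} ⟨φ, x⟩`) has a solution, then both
have solutions and their optimal values are equal. -/
theorem strong_duality_II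
    {X : Type*} [NormedAddCommGroup X] [NormedSpace ℝ X] [CompleteSpace X]
    (D : Set X) (hD : IsGPCS D) (hDne : D.Nonempty)
    (domf : Set X) (hdomf : IsGPCS domf) (hdomne : domf.Nonempty)
    (m : ℕ) (v : Fin (m + 1) → X →L[ℝ] ℝ) (β : Fin (m + 1) → ℝ)
    (f : X → EReal)
    (hf : ∀ x ∈ domf,
      f x = ((Finset.univ.sup' Finset.univ_nonempty fun k => v k x + β k : ℝ) : EReal))
    (hf' : ∀ x ∉ domf, f x = ⊤)
    (hclosed : IsClosed (D - domf))
    (g : (X →L[ℝ] ℝ) → EReal)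
    (hg : ∀ φ : X →L[ℝ] ℝ,
      g φ = -(⨆ x : X, ((((-φ) x : ℝ) : EReal) - f x)) - ⨆ x ∈ D, ((φ x : ℝ) : EReal))
    (hsol : (∃ u, u ∈ D ∧ f u ≠ ⊤ ∧ f u ≠ ⊥ ∧ ∀ x ∈ D, f u ≤ f x) ∨
      (∃ φ : X →L[ℝ] ℝ, g φ ≠ ⊤ ∧ g φ ≠ ⊥ ∧ ∀ ψ : X →L[ℝ] ℝ, g ψ ≤ g φ)) :
    (∃ u, u ∈ D ∧ f u ≠ ⊤ ∧ f u ≠ ⊥ ∧ ∀ x ∈ D, f u ≤ f x) ∧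
      (∃ φ : X →L[ℝ] ℝ, g φ ≠ ⊤ ∧ g φ ≠ ⊥ ∧ ∀ ψ : X →L[ℝ] ℝ, g ψ ≤ g φ) ∧
      (⨅ x ∈ D, f x) = ⨆ ψ : X →L[ℝ] ℝ, g ψ := by
  have hFk : ∀ x c, (Finset.univ.sup' Finset.univ_nonempty (fun k => v k x + β k) : ℝ) ≤ c ↔
      ∀ k, v k x + β k ≤ c := fun x c => by simp
  have hFk' : ∀ x c, c ≤ (Finset.univ.sup' Finset.univ_nonempty (fun k => v k x + β k) : ℝ) ↔
      ∃ k, c ≤ v k x + β k := fun x c => by simp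
  generalize hF : (fun x => (Finset.univ.sup' Finset.univ_nonempty (fun k => v k x + β k) : ℝ)) = F
    at *
  have hFx : ∀ x, (Finset.univ.sup' Finset.univ_nonempty (fun k => v k x + β k) : ℝ) = F x :=
    fun x => congrFun hF x
  simp only [hFx] at hf hFk hFk'
  have W1 : ∀ (φ : X →L[ℝ] ℝ) (c : ℝ), (∀ x ∈ domf, ∀ d ∈ D, c ≤ F x + φ x - φ d) →
      (c : EReal) ≤ g φ := by
    intro φ c h
    rw [hg]
    obtain ⟨d0, hd0⟩ := hDne
    obtain ⟨x0, hx0⟩ := hdomne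
    have hb : (⨆ x ∈ D, ((φ x : ℝ) : EReal)) ≠ ⊥ := by
      intro hb
      have : ((φ d0 : ℝ) : EReal) ≤ ⨆ x ∈ D, ((φ x : ℝ) : EReal) :=
        le_iSup₂ (f := fun x (_ : x ∈ D) => ((φ x : ℝ) : EReal)) d0 hd0
      rw [hb, le_bot_iff] at this
      exact EReal.coe_ne_bot _ this
    have hle : ∀ x ∈ domf, (⨆ x ∈ D, ((φ x : ℝ) : EReal)) ≤ ((F x + φ x - c : ℝ) : EReal) := by
      intro x hx
      refine iSup₂_le fun d hd => ?_
      exact EReal.coe_le_coe_iff.2 (by linarith [h x hx d hd])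
    have ht : (⨆ x ∈ D, ((φ x : ℝ) : EReal)) ≠ ⊤ :=
      ((hle x0 hx0).trans_lt (EReal.coe_lt_top _)).ne
    generalize (⨆ x ∈ D, ((φ x : ℝ) : EReal)) = s at *
    lift s to ℝ using ⟨ht, hb⟩
    have hA : (⨆ x : X, ((((-φ) x : ℝ) : EReal) - f x)) ≤ ((-c - s : ℝ) : EReal) := by
      refine iSup_le fun x => ?_
      by_cases hx : x ∈ domf
      · rw [hf x hx, ← EReal.coe_sub]
        have := EReal.coe_le_coe_iff.1 (hle x hx)
        refine EReal.coe_le_coe_iff.2 ?_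
        rw [ContinuousLinearMap.neg_apply]
        linarith
      · rw [hf' x hx]
        simp
    have h2 := EReal.sub_le_sub (EReal.neg_le_neg_iff.2 hA) (le_refl (s : EReal))
    refine le_trans ?_ h2
    rw [← EReal.coe_neg, ← EReal.coe_sub]
    exact EReal.coe_le_coe_iff.2 (by linarith)
  have W2 : ∀ (φ : X →L[ℝ] ℝ), ∀ x ∈ domf, ∀ d ∈ D, g φ ≤ ((F x + φ x - φ d : ℝ) : EReal) := by
    intro φ x hx d hd
    rw [hg]
    have h1 : (((-φ x - F x : ℝ)) : EReal) ≤ ⨆ x : X, ((((-φ) x : ℝ) : EReal) - f x) := by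
      refine le_trans (le_of_eq ?_) (le_iSup (fun x : X => ((((-φ) x : ℝ) : EReal) - f x)) x)
      rw [hf x hx, ← EReal.coe_sub]
      rfl
    have h2 : ((φ d : ℝ) : EReal) ≤ ⨆ x ∈ D, ((φ x : ℝ) : EReal) :=
      le_iSup₂ (f := fun x (_ : x ∈ D) => ((φ x : ℝ) : EReal)) d hd
    refine (EReal.sub_le_sub (EReal.neg_le_neg_iff.2 h1) h2).trans ?_
    rw [← EReal.coe_neg, ← EReal.coe_sub]
    exact EReal.coe_le_coe_iff.2 (by linarith)
  have hP : ∃ u, u ∈ D ∧ f u ≠ ⊤ ∧ f u ≠ ⊥ ∧ ∀ x ∈ D, f u ≤ f x := by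
    rcases hsol with hs | ⟨φ, hφt, hφb, hφ⟩
    · exact hs
    · obtain ⟨c, hc⟩ : ∃ c : ℝ, (c : EReal) = g φ := ⟨(g φ).toReal, EReal.coe_toReal hφt hφb⟩
      have hcW : ∀ x ∈ domf, ∀ d ∈ D, c ≤ F x + φ x - φ d := fun x hx d hd => by
        have := W2 φ x hx d hd
        rw [← hc] at this
        exact EReal.coe_le_coe_iff.1 this
      have hfeas : ∃ u, u ∈ D ∧ u ∈ domf := by
        by_contra hcon
        have h0 : (0 : X) ∉ D - domf := by
          rintro ⟨d, hd, e, he, hde⟩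
          have : d = e := sub_eq_zero.1 hde
          exact hcon ⟨d, hd, this ▸ he⟩
        have hconv : Convex ℝ (D - domf) := by
          obtain ⟨_, _, _, _, _, h1, _⟩ := gpcs_repr hD
          obtain ⟨_, _, _, _, _, h2, _⟩ := gpcs_repr hdomf
          exact h1.sub h2
        obtain ⟨ψ, t, hψ, ht⟩ := geometric_hahn_banach_closed_point hconv hclosed h0
        rw [map_zero] at ht
        have h1 := W1 (φ + ψ) (c - t) (fun x hx d hd => by
          have h2 := hψ (d - x) ⟨d, hd, x, hx, rfl⟩
          have h3 := hcW x hx d hd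
          rw [map_sub] at h2
          simp only [ContinuousLinearMap.add_apply]
          linarith)
        have h2 := h1.trans (hφ (φ + ψ))
        rw [← hc] at h2
        have := EReal.coe_le_coe_iff.1 h2
        linarith
      obtain ⟨u0, hu0D, hu0E⟩ := hfeas
      have hbdd : BddBelow (F '' (D ∩ domf)) := ⟨c, by
        rintro _ ⟨x, hx, rfl⟩
        have := hcW x hx.2 x hx.1
        linarith⟩
      have hne : (F '' (D ∩ domf)).Nonempty := ⟨_, u0, ⟨hu0D, hu0E⟩, rfl⟩
      obtain ⟨u, huD, huE, hu⟩ := primal_attain hD hdomf v β u0 hu0D hu0E (sInf (F '' (D ∩ domf)))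
        (by
          intro e he
          obtain ⟨_, ⟨x, hx, rfl⟩, hlt⟩ := exists_lt_of_csInf_lt hne
            (lt_add_of_pos_right (sInf (F '' (D ∩ domf))) he)
          exact ⟨x, hx.1, hx.2, (hFk x _).1 hlt.le⟩)
      refine ⟨u, huD, ?_, ?_, fun x hx => ?_⟩
      · rw [hf u huE]; exact EReal.coe_ne_top _
      · rw [hf u huE]; exact EReal.coe_ne_bot _
      · by_cases hxE : x ∈ domf
        · rw [hf u huE, hf x hxE]
          exact EReal.coe_le_coe_iff.2 (((hFk u _).2 hu).trans (csInf_le hbdd ⟨x, ⟨hx, hxE⟩, rfl⟩))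
        · rw [hf' x hxE]; exact le_top
  refine ⟨hP, ?_⟩
  obtain ⟨u, huD, hut, -, hu⟩ := hP
  have huE : u ∈ domf := by
    by_contra hcon
    exact hut (hf' u hcon)
  obtain ⟨φ, hφ⟩ := dual_attain hD hdomf hclosed v β u huD huE (F u) ((hFk u _).1 le_rfl) (by
    intro x hxD hxE
    have := hu x hxD
    rw [hf u huE, hf x hxE] at this
    exact (hFk' x _).1 (EReal.coe_le_coe_iff.1 this))
  have hle : ∀ ψ, g ψ ≤ (F u : EReal) := fun ψ => by
    have := W2 ψ u huE u huD
    rwa [add_sub_cancel_right] at this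
  have heq : g φ = (F u : EReal) := le_antisymm (hle φ)
    (W1 φ _ fun x hx d hd => hφ x hx d hd (F x) ((hFk x _).1 le_rfl))
  refine ⟨⟨φ, ?_, ?_, fun ψ => ?_⟩, ?_⟩
  · rw [heq]; exact EReal.coe_ne_top _
  · rw [heq]; exact EReal.coe_ne_bot _
  · rw [heq]; exact hle ψ
  · apply le_antisymm
    · refine (iInf₂_le u huD).trans ?_
      rw [hf u huE, ← heq]
      exact le_iSup g φ
    · refine iSup_le fun ψ => (hle ψ).trans ?_
      rw [← hf u huE]
      exact le_iInf₂ hu
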